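/- arXiv:1208.5289 — 4 statements merged into one kernel-verified Lean document; each statement's English description precedes it below -/
import Mathlib

section
/- There exists a constant c > 0 such that the following holds. Let P be a set of n points in the plane ℝ² (with n ≥ 2) such that at most √n points of P are collinear. Then P can be partitioned into at most c·√n·(log n)^(3/2) parts such that each part is in general position. -/
/-- A finite point set is in general position if no three of its points are collinear. -/
def GeneralPosition (S : Finset (ℝ × ℝ)) : Prop :=
  ∀ T ⊆ S, Collinear ℝ (T : Set (ℝ × ℝ)) → T.card ≤ 2

/-- Slope of the segment joining the points `(X p.1, Y p.1)` and `(X p.2, Y p.2)`. -/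
noncomputable def segSlope {α : Type*} (X Y : α → ℝ) (e : α × α) : ℝ :=
  (Y e.2 - Y e.1) / (X e.2 - X e.1)

/-- Height at abscissa `x` of the line through the two points of `e`. -/
noncomputable def segHeight {α : Type*} (X Y : α → ℝ) (e : α × α) (x : ℝ) : ℝ :=
  Y e.1 + segSlope X Y e * (x - X e.1)

/-- A straight-line drawing: edges are oriented from left to right, and no vertex lies in the
interior of an edge. -/
structure IsDrawing {α : Type*} (X Y : α → ℝ) (V : Finset α) (E : Finset (α × α)) : Prop where
  fst_mem : ∀ e ∈ E, e.1 ∈ V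
  snd_mem : ∀ e ∈ E, e.2 ∈ V
  lt : ∀ e ∈ E, X e.1 < X e.2
  vertex : ∀ e ∈ E, ∀ v ∈ V, X e.1 < X v → X v < X e.2 → Y v ≠ segHeight X Y e (X v)

/-- The interiors of two segments meet above a common abscissa. -/
def SegCross {α : Type*} (X Y : α → ℝ) (e f : α × α) : Prop :=
  ∃ x, X e.1 < x ∧ x < X e.2 ∧ X f.1 < x ∧ x < X f.2 ∧ segHeight X Y e x = segHeight X Y f x

section Planar

variable {α : Type*} {X Y : α → ℝ} {V : Finset α} {E : Finset (α × α)}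

lemma segHeight_fst (e : α × α) : segHeight X Y e (X e.1) = Y e.1 := by
  simp [segHeight]

lemma segHeight_snd {e : α × α} (he : X e.1 < X e.2) : segHeight X Y e (X e.2) = Y e.2 := by
  have : X e.2 - X e.1 ≠ 0 := (sub_pos.2 he).ne'
  rw [segHeight, segSlope, div_mul_cancel₀ _ this]
  ring

lemma segHeight_sub (e : α × α) (x y : ℝ) :
    segHeight X Y e y = segHeight X Y e x + segSlope X Y e * (y - x) := by
  simp only [segHeight]; ring

lemma continuous_segHeight (e : α × α) : Continuous (segHeight X Y e) := by
  unfold segHeight; fun_prop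

/-- Two edges of a drawing on a common line with overlapping interiors coincide. -/
lemma IsDrawing.eq_of_overlap (hX : Function.Injective X) (hE : IsDrawing X Y V E)
    {e f : α × α} (he : e ∈ E) (hf : f ∈ E)
    (h : ∀ x, segHeight X Y e x = segHeight X Y f x) {x : ℝ}
    (h1 : X e.1 < x) (h2 : x < X e.2) (h3 : X f.1 < x) (h4 : x < X f.2) : e = f := by
  have hel := hE.lt e he
  have hfl := hE.lt f hf
  have a1 : X e.1 = X f.1 := by
    rcases lt_trichotomy (X e.1) (X f.1) with hlt | heq | hlt
    · exact absurd (by rw [h, segHeight_fst])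
        (hE.vertex e he f.1 (hE.fst_mem f hf) hlt (by linarith))
    · exact heq
    · exact absurd (by rw [← h, segHeight_fst])
        (hE.vertex f hf e.1 (hE.fst_mem e he) hlt (by linarith))
  have a2 : X e.2 = X f.2 := by
    rcases lt_trichotomy (X e.2) (X f.2) with hlt | heq | hlt
    · exact absurd (by rw [← h, segHeight_snd hel])
        (hE.vertex f hf e.2 (hE.snd_mem e he) (by linarith) hlt)
    · exact heq
    · exact absurd (by rw [h, segHeight_snd hfl])
        (hE.vertex e he f.2 (hE.snd_mem f hf) (by linarith) hlt)
  exact Prod.ext (hX a1) (hX a2)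

lemma segHeight_eq_of_slope_eq {e f : α × α} (hs : segSlope X Y e = segSlope X Y f) {x : ℝ}
    (hx : segHeight X Y e x = segHeight X Y f x) (y : ℝ) :
    segHeight X Y e y = segHeight X Y f y := by
  rw [segHeight_sub e x y, segHeight_sub f x y, hs, hx]

lemma IsDrawing.eq_of_fst_eq (hX : Function.Injective X) (hE : IsDrawing X Y V E)
    {e f : α × α} (he : e ∈ E) (hf : f ∈ E) (h : e.1 = f.1)
    (hs : segSlope X Y e = segSlope X Y f) : e = f := by
  obtain ⟨x, hx1, hx2⟩ := exists_between (lt_min (hE.lt e he) (h ▸ hE.lt f hf : X e.1 < X f.2))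
  have := lt_min_iff.1 hx2
  refine hE.eq_of_overlap hX he hf (segHeight_eq_of_slope_eq hs (x := X e.1) ?_) hx1 this.1
    (h ▸ hx1) this.2
  rw [segHeight_fst, h, segHeight_fst]

lemma IsDrawing.eq_of_snd_eq (hX : Function.Injective X) (hE : IsDrawing X Y V E)
    {e f : α × α} (he : e ∈ E) (hf : f ∈ E) (h : e.2 = f.2)
    (hs : segSlope X Y e = segSlope X Y f) : e = f := by
  obtain ⟨x, hx1, hx2⟩ := exists_between (max_lt (hE.lt e he) (h ▸ hE.lt f hf : X f.1 < X e.2))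
  have := max_lt_iff.1 hx1
  refine hE.eq_of_overlap hX he hf (segHeight_eq_of_slope_eq hs (x := X e.2) ?_) this.1 hx2
    this.2 (h ▸ hx2)
  rw [segHeight_snd (hE.lt e he), h, segHeight_snd (hE.lt f hf)]

/-- Edges which do not cross keep their vertical order on their common range. -/
lemma segHeight_le_of_lt {e f : α × α} (hc : ¬ SegCross X Y e f) {x y : ℝ}
    (hxe : x ∈ Set.Icc (X e.1) (X e.2)) (hxf : x ∈ Set.Icc (X f.1) (X f.2))
    (hye : y ∈ Set.Icc (X e.1) (X e.2)) (hyf : y ∈ Set.Icc (X f.1) (X f.2))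
    (h : segHeight X Y e x < segHeight X Y f x) : segHeight X Y e y ≤ segHeight X Y f y := by
  by_contra! hlt
  have hcont : Continuous (fun z => segHeight X Y e z - segHeight X Y f z) :=
    (continuous_segHeight e).sub (continuous_segHeight f)
  rcases le_total x y with hxy | hxy
  · obtain ⟨z, hz, hz0⟩ := intermediate_value_Ioo hxy hcont.continuousOn
      (show (0 : ℝ) ∈ _ from ⟨by linarith, by linarith⟩)
    refine hc ⟨z, ?_⟩
    simp only [Set.mem_Icc, Set.mem_Ioo] at *
    refine ⟨?_, ?_, ?_, ?_, ?_⟩ <;> linarith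
  · obtain ⟨z, hz, hz0⟩ := intermediate_value_Ioo' hxy hcont.continuousOn
      (show (0 : ℝ) ∈ _ from ⟨by linarith, by linarith⟩)
    refine hc ⟨z, ?_⟩
    simp only [Set.mem_Icc, Set.mem_Ioo] at *
    refine ⟨?_, ?_, ?_, ?_, ?_⟩ <;> linarith

/-- The data attached to an edge `e` which is not the steepest edge leaving its left endpoint:
the next steeper edge `f`, and the leftmost vertex `v` of the wedge between `e` and `f`. -/
structure IsWedge (X Y : α → ℝ) (V : Finset α) (E : Finset (α × α)) (e f : α × α) (v : α) :
    Prop where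
  left_mem : e ∈ E
  right_mem : f ∈ E
  fst_eq : f.1 = e.1
  slope_lt : segSlope X Y e < segSlope X Y f
  next : ∀ g ∈ E, g.1 = e.1 → segSlope X Y e < segSlope X Y g → segSlope X Y f ≤ segSlope X Y g
  mem : v ∈ V
  lt : X e.1 < X v
  le_left : X v ≤ X e.2
  le_right : X v ≤ X f.2
  below : segHeight X Y e (X v) ≤ Y v
  above : Y v ≤ segHeight X Y f (X v)
  first : ∀ w ∈ V, X e.1 < X w → X w < X v → segHeight X Y e (X w) ≤ Y w →
    ¬ Y w ≤ segHeight X Y f (X w)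

lemma IsWedge.height_lt {e f : α × α} {v : α} (w : IsWedge X Y V E e f v) {x : ℝ}
    (hx : X e.1 < x) : segHeight X Y e x < segHeight X Y f x := by
  simp only [segHeight, w.fst_eq]
  nlinarith [w.slope_lt]

/-- No edge enters the wedge before its first vertex. -/
lemma IsWedge.no_edge (hX : Function.Injective X) (hE : IsDrawing X Y V E)
    (hc : ∀ e ∈ E, ∀ f ∈ E, e ≠ f → ¬ SegCross X Y e f) {e f : α × α} {v : α}
    (w : IsWedge X Y V E e f v) {g : α × α} (hg : g ∈ E) {x : ℝ} (hx : X e.1 < x)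
    (hxv : x ≤ X v) (hgx : X g.1 < x) (hxg : x ≤ X g.2)
    (h1 : segHeight X Y e x < segHeight X Y g x) (h2 : segHeight X Y g x < segHeight X Y f x) :
    False := by
  have hge : g ≠ e := by rintro rfl; exact lt_irrefl _ h1
  have hgf : g ≠ f := by rintro rfl; exact lt_irrefl _ h2
  have ceg := hc e w.left_mem g hg hge.symm
  have cge := hc g hg e w.left_mem hge
  have cgf := hc g hg f w.right_mem hgf
  have cfg := hc f w.right_mem g hg hgf.symm
  have hel := w.le_left
  have hfl := w.le_right
  have hfe : X f.1 = X e.1 := by rw [w.fst_eq]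
  rcases lt_or_ge (X e.1) (X g.1) with hlt | hge'
  · refine w.first g.1 (hE.fst_mem g hg) hlt (by linarith) ?_ ?_
    · rw [← segHeight_fst (X := X) (Y := Y) g]
      refine segHeight_le_of_lt ceg ?_ ?_ ?_ ?_ h1 <;> constructor <;> linarith
    · rw [← segHeight_fst (X := X) (Y := Y) g]
      refine segHeight_le_of_lt cgf ?_ ?_ ?_ ?_ h2 <;> constructor <;> linarith
  · have e0 : segHeight X Y e (X e.1) = Y e.1 := segHeight_fst e
    have f0 : segHeight X Y f (X e.1) = Y e.1 := by rw [← w.fst_eq, segHeight_fst]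
    rcases lt_trichotomy (segHeight X Y g (X e.1)) (Y e.1) with hlt | heq | hlt
    · refine absurd h1 (not_lt.2 ?_)
      refine segHeight_le_of_lt cge ?_ ?_ ?_ ?_ (e0.symm ▸ hlt) <;> constructor <;> linarith
    · rcases hge'.lt_or_eq with hlt | heq'
      · exact hE.vertex g hg e.1 (hE.fst_mem e w.left_mem) hlt (by linarith) heq.symm
      · have hge1 : g.1 = e.1 := hX heq'
        have hd : 0 < x - X e.1 := by linarith
        simp only [segHeight, hge1, w.fst_eq] at h1 h2
        have a1 : segSlope X Y e < segSlope X Y g := by nlinarith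
        have a2 : segSlope X Y g < segSlope X Y f := by nlinarith
        exact absurd (w.next g hg hge1 a1) (not_le.2 a2)
    · refine absurd h2 (not_lt.2 ?_)
      refine segHeight_le_of_lt cfg ?_ ?_ ?_ ?_ (f0.symm ▸ hlt) <;> constructor <;> linarith

lemma exists_lt_segHeight_lt {e f : α × α} {x m : ℝ} (hm : m < x)
    (h : segHeight X Y e x < segHeight X Y f x) :
    ∃ z, m < z ∧ z < x ∧ segHeight X Y e z < segHeight X Y f z := by
  have h1 : ∀ᶠ z in nhdsWithin x (Set.Iio x), segHeight X Y e z < segHeight X Y f z :=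
    ((continuous_segHeight e).continuousAt.eventually_lt
      (continuous_segHeight f).continuousAt h).filter_mono nhdsWithin_le_nhds
  have h2 : ∀ᶠ z in nhdsWithin x (Set.Iio x), z ∈ Set.Ioo m x := Ioo_mem_nhdsLT hm
  obtain ⟨z, h3, h4⟩ := (h1.and h2).exists
  exact ⟨z, h4.1, h4.2, h3⟩

/-- If the first vertex of the wedge is the right end of `e`, then `e` is the upmost edge
arriving there. -/
lemma IsWedge.slope_le_of_snd_eq (hX : Function.Injective X) (hE : IsDrawing X Y V E)
    (hc : ∀ e ∈ E, ∀ f ∈ E, e ≠ f → ¬ SegCross X Y e f) {e f : α × α}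
    (w : IsWedge X Y V E e f e.2) {g : α × α} (hg : g ∈ E) (h : g.2 = e.2) :
    segSlope X Y e ≤ segSlope X Y g := by
  by_contra! hlt
  have hgl := hE.lt g hg
  have ge : segHeight X Y g (X e.2) = Y e.2 := by rw [← h, segHeight_snd hgl]
  have ee : segHeight X Y e (X e.2) = Y e.2 := segHeight_snd w.lt
  have hh : segHeight X Y g (X e.2) < segHeight X Y f (X e.2) := by
    rw [ge, ← ee]; exact w.height_lt w.lt
  obtain ⟨z, hz1, hz2, hz3⟩ := exists_lt_segHeight_lt (max_lt w.lt (h ▸ hgl : X g.1 < X e.2)) hh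
  have := max_lt_iff.1 hz1
  refine w.no_edge hX hE hc hg this.1 hz2.le this.2 (h ▸ hz2.le) ?_ hz3
  rw [segHeight_sub e (X e.2) z, segHeight_sub g (X e.2) z, ee, ge]
  nlinarith

lemma IsWedge.le_slope_of_snd_eq (hX : Function.Injective X) (hE : IsDrawing X Y V E)
    (hc : ∀ e ∈ E, ∀ f ∈ E, e ≠ f → ¬ SegCross X Y e f) {e f : α × α}
    (w : IsWedge X Y V E e f f.2) {g : α × α} (hg : g ∈ E) (h : g.2 = f.2) :
    segSlope X Y g ≤ segSlope X Y f := by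
  by_contra! hlt
  have hgl := hE.lt g hg
  have ge : segHeight X Y g (X f.2) = Y f.2 := by rw [← h, segHeight_snd hgl]
  have ff : segHeight X Y f (X f.2) = Y f.2 := segHeight_snd (w.fst_eq ▸ w.lt)
  have hh : segHeight X Y e (X f.2) < segHeight X Y g (X f.2) := by
    rw [ge, ← ff]; exact w.height_lt w.lt
  obtain ⟨z, hz1, hz2, hz3⟩ := exists_lt_segHeight_lt (max_lt w.lt (h ▸ hgl : X g.1 < X f.2)) hh
  have := max_lt_iff.1 hz1
  refine w.no_edge hX hE hc hg this.1 hz2.le this.2 (h ▸ hz2.le) hz3 ?_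
  rw [segHeight_sub f (X f.2) z, segHeight_sub g (X f.2) z, ff, ge]
  nlinarith

lemma IsWedge.strict (hX : Function.Injective X) (hE : IsDrawing X Y V E)
    {e f : α × α} {v : α} (w : IsWedge X Y V E e f v) (h1 : v ≠ e.2) (h2 : v ≠ f.2) :
    X v < X e.2 ∧ X v < X f.2 ∧ segHeight X Y e (X v) < Y v ∧ Y v < segHeight X Y f (X v) := by
  have a1 : X v < X e.2 := lt_of_le_of_ne w.le_left (fun h => h1 (hX h))
  have a2 : X v < X f.2 := lt_of_le_of_ne w.le_right (fun h => h2 (hX h))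
  exact ⟨a1, a2, lt_of_le_of_ne w.below (hE.vertex e w.left_mem v w.mem w.lt a1).symm,
    lt_of_le_of_ne w.above (hE.vertex f w.right_mem v w.mem (w.fst_eq ▸ w.lt) a2)⟩

lemma IsWedge.height_le (hX : Function.Injective X) (hE : IsDrawing X Y V E)
    (hc : ∀ e ∈ E, ∀ f ∈ E, e ≠ f → ¬ SegCross X Y e f) {e f : α × α} {v : α}
    (w : IsWedge X Y V E e f v) {g : α × α} (hg : g ∈ E)
    (h1 : X g.1 < X v) (h2 : X v < X g.2) (h3 : segHeight X Y g (X v) < Y v) :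
    segHeight X Y g (X v) ≤ segHeight X Y e (X v) := by
  by_contra! hlt
  exact w.no_edge hX hE hc hg w.lt le_rfl h1 h2.le hlt (h3.trans_le w.above)

lemma exists_isWedge (hE : IsDrawing X Y V E) {e : α × α}
    (he : e ∈ E) (h : ∃ f ∈ E, f.1 = e.1 ∧ segSlope X Y e < segSlope X Y f) :
    ∃ f v, IsWedge X Y V E e f v := by
  classical
  obtain ⟨f, hf, hmin⟩ := Finset.exists_min_image
    (E.filter fun f => f.1 = e.1 ∧ segSlope X Y e < segSlope X Y f) (segSlope X Y)
    (by obtain ⟨f, h1, h2⟩ := h; exact ⟨f, Finset.mem_filter.2 ⟨h1, h2⟩⟩)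
  obtain ⟨hfE, hfe, hsl⟩ := Finset.mem_filter.1 hf
  have hel := hE.lt e he
  have hfl := hE.lt f hfE
  have hlt : ∀ x, X e.1 < x → segHeight X Y e x < segHeight X Y f x := by
    intro x hx
    simp only [segHeight, hfe]
    nlinarith
  obtain ⟨v, hv, hvmin⟩ := Finset.exists_min_image
    (V.filter fun v => X e.1 < X v ∧ X v ≤ X e.2 ∧ X v ≤ X f.2 ∧
      segHeight X Y e (X v) ≤ Y v ∧ Y v ≤ segHeight X Y f (X v)) X (by
    rcases le_total (X e.2) (X f.2) with hle | hle
    · refine ⟨e.2, Finset.mem_filter.2 ⟨hE.snd_mem e he, hel, le_rfl, hle, ?_, ?_⟩⟩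
      · rw [segHeight_snd hel]
      · rw [← segHeight_snd (Y := Y) hel]; exact (hlt _ hel).le
    · rw [hfe] at hfl
      refine ⟨f.2, Finset.mem_filter.2 ⟨hE.snd_mem f hfE, hfl, hle, le_rfl, ?_, ?_⟩⟩
      · rw [← segHeight_snd (Y := Y) (hE.lt f hfE)]; exact (hlt _ hfl).le
      · rw [segHeight_snd (hE.lt f hfE)])
  obtain ⟨hvV, v1, v2, v3, v4, v5⟩ := Finset.mem_filter.1 hv
  refine ⟨f, v, he, hfE, hfe, hsl, fun g hg h1 h2 => hmin g (Finset.mem_filter.2 ⟨hg, h1, h2⟩),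
    hvV, v1, v2, v3, v4, v5, fun w hw h1 h2 h3 h4 => ?_⟩
  exact absurd (hvmin w (Finset.mem_filter.2 ⟨hw, h1, by linarith, by linarith, h3, h4⟩))
    (not_le.2 h2)

/-- A crossing-free straight-line drawing has at most four times as many edges as vertices. -/
theorem IsDrawing.card_le_of_not_cross (hX : Function.Injective X) (hE : IsDrawing X Y V E)
    (hc : ∀ e ∈ E, ∀ f ∈ E, e ≠ f → ¬ SegCross X Y e f) : E.card ≤ 4 * V.card := by
  classical
  set R := E.filter fun e => ∃ f ∈ E, f.1 = e.1 ∧ segSlope X Y e < segSlope X Y f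
  set S := E.filter fun e => ¬ ∃ f ∈ E, f.1 = e.1 ∧ segSlope X Y e < segSlope X Y f
  have hRS : R.card + S.card = E.card := Finset.card_filter_add_card_filter_not _
  have hScard : S.card ≤ V.card := by
    refine Finset.card_le_card_of_injOn Prod.fst
      (fun e he => hE.fst_mem e (Finset.mem_filter.1 he).1) ?_
    intro e he f hf hef
    obtain ⟨heE, he'⟩ := Finset.mem_filter.1 he
    obtain ⟨hfE, hf'⟩ := Finset.mem_filter.1 hf
    push Not at he' hf'
    exact hE.eq_of_fst_eq hX heE hfE hef (le_antisymm (hf' e heE hef) (he' f hfE hef.symm))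
  have hw : ∀ e, ∃ f v, e ∈ R → IsWedge X Y V E e f v := by
    intro e
    by_cases he : e ∈ R
    · obtain ⟨f, v, h⟩ := exists_isWedge hE (Finset.mem_filter.1 he).1
        (Finset.mem_filter.1 he).2
      exact ⟨f, v, fun _ => h⟩
    · exact ⟨e, e.1, fun h => absurd h he⟩
  choose F W w using hw
  have hA : (R.filter fun e => W e = e.2).card ≤ V.card := by
    refine Finset.card_le_card_of_injOn W
      (fun e he => (w e (Finset.mem_filter.1 he).1).mem) ?_
    intro e he g hg heg
    obtain ⟨heR, he'⟩ := Finset.mem_filter.1 he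
    obtain ⟨hgR, hg'⟩ := Finset.mem_filter.1 hg
    have we := w e heR
    have wg := w g hgR
    have h2 : g.2 = e.2 := by rw [← he', ← hg', heg]
    rw [he'] at we
    rw [hg'] at wg
    exact hE.eq_of_snd_eq hX we.left_mem wg.left_mem h2.symm
      (le_antisymm (we.slope_le_of_snd_eq hX hE hc wg.left_mem h2)
        (wg.slope_le_of_snd_eq hX hE hc we.left_mem h2.symm))
  have hB : (R.filter fun e => W e = (F e).2).card ≤ V.card := by
    refine Finset.card_le_card_of_injOn W
      (fun e he => (w e (Finset.mem_filter.1 he).1).mem) ?_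
    intro e he g hg heg
    obtain ⟨heR, he'⟩ := Finset.mem_filter.1 he
    obtain ⟨hgR, hg'⟩ := Finset.mem_filter.1 hg
    have we := w e heR
    have wg := w g hgR
    have h2 : (F g).2 = (F e).2 := by rw [← he', ← hg', heg]
    rw [he'] at we
    rw [hg'] at wg
    have hF : F e = F g := hE.eq_of_snd_eq hX we.right_mem wg.right_mem h2.symm
      (le_antisymm (wg.le_slope_of_snd_eq hX hE hc we.right_mem h2.symm)
        (we.le_slope_of_snd_eq hX hE hc wg.right_mem h2))
    have h1 : e.1 = g.1 := by rw [← we.fst_eq, hF, wg.fst_eq]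
    refine hE.eq_of_fst_eq hX we.left_mem wg.left_mem h1 (le_antisymm ?_ ?_)
    · by_contra! hlt
      exact absurd (wg.next e we.left_mem h1 hlt) (not_le.2 (hF ▸ we.slope_lt))
    · by_contra! hlt
      exact absurd (we.next g wg.left_mem h1.symm hlt) (not_le.2 (hF ▸ wg.slope_lt))
  have hC : (R.filter fun e => W e ≠ e.2 ∧ W e ≠ (F e).2).card ≤ V.card := by
    refine Finset.card_le_card_of_injOn W
      (fun e he => (w e (Finset.mem_filter.1 he).1).mem) ?_
    intro e he g hg heg
    obtain ⟨heR, he1, he2⟩ := Finset.mem_filter.1 he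
    obtain ⟨hgR, hg1, hg2⟩ := Finset.mem_filter.1 hg
    have we := w e heR
    have wg := w g hgR
    obtain ⟨e1, e2, e3, e4⟩ := we.strict hX hE he1 he2
    obtain ⟨g1, g2, g3, g4⟩ := wg.strict hX hE hg1 hg2
    have el := we.lt
    have gl := wg.lt
    by_contra hne
    refine hc e we.left_mem g wg.left_mem hne
      ⟨X (W e), el, e1, heg ▸ gl, heg ▸ g1, le_antisymm ?_ ?_⟩
    · have := wg.height_le hX hE hc we.left_mem (heg ▸ el) (heg ▸ e1) (heg ▸ e3)
      rwa [heg]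
    · exact we.height_le hX hE hc wg.left_mem (heg ▸ gl) (heg ▸ g1) (heg ▸ g3)
  have hcov : R ⊆ (R.filter fun e => W e = e.2) ∪ (R.filter fun e => W e = (F e).2) ∪
      (R.filter fun e => W e ≠ e.2 ∧ W e ≠ (F e).2) := by
    intro e he
    simp only [Finset.mem_union, Finset.mem_filter]
    tauto
  have := Finset.card_le_card hcov
  have h1 := Finset.card_union_le ((R.filter fun e => W e = e.2) ∪
    (R.filter fun e => W e = (F e).2)) (R.filter fun e => W e ≠ e.2 ∧ W e ≠ (F e).2)
  have h2 := Finset.card_union_le (R.filter fun e => W e = e.2)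
    (R.filter fun e => W e = (F e).2)
  omega

open Finset in
lemma card_filter_const_mul [Fintype α] [DecidableEq α] {K : ℕ} (S : Finset α) (c : Fin K) :
    #{f : α → Fin K | ∀ a ∈ S, f a = c} * K ^ #S = K ^ Fintype.card α := by
  have h : ({f : α → Fin K | ∀ a ∈ S, f a = c} : Finset (α → Fin K)) =
      Fintype.piFinset fun a => if a ∈ S then {c} else univ := by
    ext f
    simp only [mem_filter, mem_univ, true_and, Fintype.mem_piFinset]
    refine forall_congr' fun a => ?_
    split_ifs with ha <;> simp [ha]
  have h2 : K ^ #S = ∏ a : α, if a ∈ S then K else 1 := by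
    rw [prod_ite_mem, univ_inter, prod_const]
  rw [h, Fintype.card_piFinset, h2, ← prod_mul_distrib, ← card_univ, ← prod_const]
  refine prod_congr rfl fun a _ => ?_
  split_ifs <;> simp

open Finset in
/-- Double counting of the pairs `(f, t)` for which the colouring `f` is constantly `c` on the
`s`-element set `S t`. -/
lemma sum_card_filter_const_mul [Fintype α] [DecidableEq α] {ι : Type*} {K s : ℕ} (T : Finset ι)
    (S : ι → Finset α) (hS : ∀ t ∈ T, #(S t) = s) (c : Fin K) :
    (∑ f : α → Fin K, #{t ∈ T | ∀ a ∈ S t, f a = c}) * K ^ s = #T * K ^ Fintype.card α := by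
  simp only [card_filter]
  rw [sum_comm, sum_mul, ← smul_eq_mul, ← sum_const]
  refine sum_congr rfl fun t ht => ?_
  rw [← card_filter, ← hS t ht, card_filter_const_mul]

open Classical in
/-- Ordered pairs of distinct crossing edges. -/
noncomputable def crossPairs (X Y : α → ℝ) (E : Finset (α × α)) : Finset ((α × α) × (α × α)) :=
  (E ×ˢ E).filter fun p => p.1 ≠ p.2 ∧ SegCross X Y p.1 p.2

lemma mem_crossPairs {p : (α × α) × (α × α)} : p ∈ crossPairs X Y E ↔
    (p.1 ∈ E ∧ p.2 ∈ E) ∧ p.1 ≠ p.2 ∧ SegCross X Y p.1 p.2 := by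
  simp only [crossPairs, Finset.mem_filter, Finset.mem_product]

lemma IsDrawing.card_le_add_card_crossPairs (hX : Function.Injective X)
    (hE : IsDrawing X Y V E) : E.card ≤ 4 * V.card + (crossPairs X Y E).card := by
  classical
  set D := (crossPairs X Y E).image Prod.fst
  have h1 : (E \ D).card ≤ 4 * V.card := by
    have hsub : ∀ e ∈ E \ D, e ∈ E := fun e he => (Finset.mem_sdiff.1 he).1
    refine IsDrawing.card_le_of_not_cross hX (X := X) (Y := Y)
      ⟨fun e he => hE.fst_mem e (hsub e he), fun e he => hE.snd_mem e (hsub e he),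
        fun e he => hE.lt e (hsub e he),
      fun e he => hE.vertex e (hsub e he)⟩ ?_
    intro e he f hf hne hcr
    refine (Finset.mem_sdiff.1 he).2 (Finset.mem_image.2 ⟨(e, f), ?_, rfl⟩)
    exact mem_crossPairs.2 ⟨⟨hsub e he, hsub f hf⟩, hne, hcr⟩
  have h2 : D.card ≤ (crossPairs X Y E).card := Finset.card_image_le
  have h3 : E.card ≤ (E \ D).card + D.card := Finset.card_le_card_sdiff_add_card
  omega

lemma IsDrawing.card_endpoints (hX : Function.Injective X) (hE : IsDrawing X Y V E)
    [DecidableEq α] {p : (α × α) × (α × α)} (hp : p ∈ crossPairs X Y E) :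
    ({p.1.1, p.1.2, p.2.1, p.2.2} : Finset α).card = 4 := by
  obtain ⟨⟨he, hf⟩, hne, x, h1, h2, h3, h4, h5⟩ := mem_crossPairs.1 hp
  obtain ⟨e, f⟩ := p
  dsimp only at *
  have hel := hE.lt e he
  have hfl := hE.lt f hf
  have n1 : e.1 ≠ e.2 := fun h => by rw [h] at hel; exact lt_irrefl _ hel
  have n2 : f.1 ≠ f.2 := fun h => by rw [h] at hfl; exact lt_irrefl _ hfl
  have n3 : e.1 ≠ f.2 := fun h => by rw [h] at h1; linarith
  have n4 : e.2 ≠ f.1 := fun h => by rw [h] at h2; linarith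
  have n5 : e.1 ≠ f.1 := by
    intro h
    refine hne (hE.eq_of_fst_eq hX he hf h ?_)
    simp only [segHeight, h] at h5
    exact mul_right_cancel₀ (sub_pos.2 h3).ne' (by linarith)
  have n6 : e.2 ≠ f.2 := by
    intro h
    refine hne (hE.eq_of_snd_eq hX he hf h ?_)
    have a := segHeight_sub (X := X) (Y := Y) e x (X f.2)
    have b := segHeight_sub (X := X) (Y := Y) f x (X f.2)
    rw [segHeight_snd hfl] at b
    rw [← h, segHeight_snd hel, h] at a
    exact mul_right_cancel₀ (sub_pos.2 h4).ne' (by linarith)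
  rw [Finset.card_insert_of_notMem, Finset.card_insert_of_notMem, Finset.card_insert_of_notMem,
    Finset.card_singleton]
  all_goals simp [*]

open Finset in
/-- The crossing inequality in its amplified form. -/
theorem IsDrawing.card_mul_sq_le [Fintype α] (hX : Function.Injective X)
    (hE : IsDrawing X Y univ E) {K : ℕ} (hK : 0 < K) :
    #E * K ^ 2 ≤ 4 * Fintype.card α * K ^ 3 + #(crossPairs X Y E) := by
  classical
  let c : Fin K := ⟨0, hK⟩
  have key : ∀ f : α → Fin K, #{e ∈ E | ∀ a ∈ ({e.1, e.2} : Finset α), f a = c} ≤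
      4 * #{v ∈ (univ : Finset α) | ∀ a ∈ ({v} : Finset α), f a = c} +
      #{p ∈ crossPairs X Y E | ∀ a ∈ ({p.1.1, p.1.2, p.2.1, p.2.2} : Finset α), f a = c} := by
    intro f
    have hsub : ∀ e ∈ ({e ∈ E | ∀ a ∈ ({e.1, e.2} : Finset α), f a = c} : Finset _), e ∈ E :=
      fun e he => (mem_filter.1 he).1
    refine (IsDrawing.card_le_add_card_crossPairs hX (X := X) (Y := Y)
      (V := {v ∈ (univ : Finset α) | ∀ a ∈ ({v} : Finset α), f a = c}) ⟨fun e he => ?_,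
      fun e he => ?_, fun e he => hE.lt e (hsub e he),
      fun e he v _ => hE.vertex e (hsub e he) v (mem_univ v)⟩).trans
      (add_le_add le_rfl (card_le_card ?_))
    · have := (mem_filter.1 he).2
      simp_all
    · have := (mem_filter.1 he).2
      simp_all
    · intro p hp
      simp only [mem_filter, mem_crossPairs] at hp ⊢
      simp only [mem_insert, mem_singleton, forall_eq_or_imp, forall_eq] at hp ⊢
      tauto
  have hsum := sum_le_sum fun f (_ : f ∈ (univ : Finset (α → Fin K))) => key f
  rw [sum_add_distrib, ← mul_sum] at hsum
  have s1 := sum_card_filter_const_mul (s := 1) (univ : Finset α) (fun v => {v}) (by simp) c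
  have s2 := sum_card_filter_const_mul (s := 2) E (fun e => {e.1, e.2})
    (fun e he => card_pair fun h => (hE.lt e he).ne (congrArg X h)) c
  have s4 := sum_card_filter_const_mul (s := 4) (crossPairs X Y E)
    (fun p => {p.1.1, p.1.2, p.2.1, p.2.2}) (fun p hp => hE.card_endpoints hX hp) c
  refine Nat.le_of_mul_le_mul_right (c := K ^ Fintype.card α) ?_ (by positivity)
  rw [card_univ] at s1
  have h := Nat.mul_le_mul_right (K ^ 4) hsum
  rw [add_mul, s4] at h
  calc #E * K ^ 2 * K ^ Fintype.card α = (#E * K ^ Fintype.card α) * K ^ 2 := by ring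
    _ = _ := by rw [← s2, mul_assoc, ← pow_add]
    _ ≤ _ := h
    _ = 4 * (Fintype.card α * K ^ Fintype.card α) * K ^ 3 +
        #(crossPairs X Y E) * K ^ Fintype.card α := by rw [← s1]; ring
    _ = _ := by ring

end Planar

section Lines

variable {α : Type*} [Fintype α] {X Y : α → ℝ}

open Classical in
/-- The points on the line `y = ℓ.1 * x + ℓ.2`. -/
noncomputable def linePts (X Y : α → ℝ) (ℓ : ℝ × ℝ) : Finset α :=
  Finset.univ.filter fun i => Y i = ℓ.1 * X i + ℓ.2

lemma mem_linePts {ℓ : ℝ × ℝ} {i : α} : i ∈ linePts X Y ℓ ↔ Y i = ℓ.1 * X i + ℓ.2 := by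
  simp [linePts]

lemma line_eq_of_mem {ℓ ℓ' : ℝ × ℝ} {i j : α} (h : X i ≠ X j) (h1 : i ∈ linePts X Y ℓ)
    (h2 : j ∈ linePts X Y ℓ) (h3 : i ∈ linePts X Y ℓ') (h4 : j ∈ linePts X Y ℓ') : ℓ = ℓ' := by
  rw [mem_linePts] at *
  have h5 : ℓ.1 = ℓ'.1 := mul_right_cancel₀ (sub_ne_zero.2 h) (by linarith)
  refine Prod.ext h5 ?_
  rw [h5] at h1
  linarith

lemma segHeight_eq_of_mem {ℓ : ℝ × ℝ} {e : α × α} (h : X e.1 < X e.2)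
    (h1 : e.1 ∈ linePts X Y ℓ) (h2 : e.2 ∈ linePts X Y ℓ) (x : ℝ) :
    segHeight X Y e x = ℓ.1 * x + ℓ.2 := by
  rw [mem_linePts] at *
  have hs : segSlope X Y e = ℓ.1 := by
    rw [segSlope, div_eq_iff (sub_pos.2 h).ne']; linarith
  rw [segHeight, hs, h1]; ring

open Classical in
/-- Pairs of consecutive points on the line `ℓ`. -/
noncomputable def lineEdges (X Y : α → ℝ) (ℓ : ℝ × ℝ) : Finset (α × α) :=
  Finset.univ.filter fun e => X e.1 < X e.2 ∧ e.1 ∈ linePts X Y ℓ ∧ e.2 ∈ linePts X Y ℓ ∧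
    ∀ v ∈ linePts X Y ℓ, X e.1 < X v → ¬ X v < X e.2

lemma mem_lineEdges {ℓ : ℝ × ℝ} {e : α × α} : e ∈ lineEdges X Y ℓ ↔
    X e.1 < X e.2 ∧ e.1 ∈ linePts X Y ℓ ∧ e.2 ∈ linePts X Y ℓ ∧
    ∀ v ∈ linePts X Y ℓ, X e.1 < X v → ¬ X v < X e.2 := by
  simp [lineEdges]

lemma card_linePts_le (hX : Function.Injective X) (ℓ : ℝ × ℝ) :
    (linePts X Y ℓ).card ≤ (lineEdges X Y ℓ).card + 1 := by
  classical
  rcases (linePts X Y ℓ).eq_empty_or_nonempty with h0 | hne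
  · simp [h0]
  obtain ⟨r, hr, hmax⟩ := Finset.exists_max_image _ X hne
  have hsub : (linePts X Y ℓ).erase r ⊆ (lineEdges X Y ℓ).image Prod.fst := by
    intro i hi
    obtain ⟨hir, hi⟩ := Finset.mem_erase.1 hi
    obtain ⟨j, hj, hjmin⟩ := Finset.exists_min_image
      ((linePts X Y ℓ).filter fun j => X i < X j) X
      ⟨r, Finset.mem_filter.2 ⟨hr, lt_of_le_of_ne (hmax i hi) fun h => hir (hX h)⟩⟩
    obtain ⟨hj, hij⟩ := Finset.mem_filter.1 hj
    refine Finset.mem_image.2 ⟨(i, j), mem_lineEdges.2 ⟨hij, hi, hj, fun v hv h1 => ?_⟩, rfl⟩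
    exact not_lt.2 (hjmin v (Finset.mem_filter.2 ⟨hv, h1⟩))
  have h1 := Finset.card_le_card hsub
  have h2 : ((lineEdges X Y ℓ).image Prod.fst).card ≤ _ := Finset.card_image_le
  rw [Finset.card_erase_of_mem hr] at h1
  omega

open Finset in
/-- The drawing whose edges join consecutive points on the lines of `L`. -/
lemma isDrawing_biUnion_lineEdges [DecidableEq α] (L : Finset (ℝ × ℝ)) :
    IsDrawing X Y univ (L.biUnion (lineEdges X Y)) := by
  refine ⟨fun _ _ => mem_univ _, fun _ _ => mem_univ _, fun e he => ?_, fun e he v _ h1 h2 h => ?_⟩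
  · obtain ⟨ℓ, -, he⟩ := mem_biUnion.1 he
    exact (mem_lineEdges.1 he).1
  · obtain ⟨ℓ, -, he⟩ := mem_biUnion.1 he
    obtain ⟨a, b, c, d⟩ := mem_lineEdges.1 he
    refine d v (mem_linePts.2 ?_) h1 h2
    rw [h, segHeight_eq_of_mem a b c]

open Finset in
lemma sum_card_lineEdges [DecidableEq α] (L : Finset (ℝ × ℝ)) :
    #(L.biUnion (lineEdges X Y)) = ∑ ℓ ∈ L, #(lineEdges X Y ℓ) := by
  refine card_biUnion fun ℓ _ ℓ' _ hne => disjoint_left.2 fun e h1 h2 => hne ?_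
  obtain ⟨a, b, c, -⟩ := mem_lineEdges.1 h1
  obtain ⟨-, b', c', -⟩ := mem_lineEdges.1 h2
  exact line_eq_of_mem a.ne b c b' c'

open Finset in
lemma card_crossPairs_le [DecidableEq α] (hX : Function.Injective X) (L : Finset (ℝ × ℝ)) :
    #(crossPairs X Y (L.biUnion (lineEdges X Y))) ≤ #L ^ 2 := by
  classical
  have hE := isDrawing_biUnion_lineEdges (X := X) (Y := Y) L
  rw [sq, ← card_product]
  have hl : ∀ e, ∃ ℓ, e ∈ L.biUnion (lineEdges X Y) → ℓ ∈ L ∧ e ∈ lineEdges X Y ℓ := by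
    intro e
    by_cases he : e ∈ L.biUnion (lineEdges X Y)
    · obtain ⟨ℓ, h⟩ := mem_biUnion.1 he
      exact ⟨ℓ, fun _ => h⟩
    · exact ⟨0, fun h => absurd h he⟩
  choose F hF using hl
  have hh : ∀ e ∈ L.biUnion (lineEdges X Y), ∀ x,
      segHeight X Y e x = (F e).1 * x + (F e).2 := fun e he => by
    obtain ⟨a, b, c, -⟩ := mem_lineEdges.1 (hF e he).2
    exact segHeight_eq_of_mem a b c
  refine card_le_card_of_injOn (fun p => (F p.1, F p.2)) (fun p hp => ?_) ?_
  · obtain ⟨⟨he, hf⟩, -⟩ := mem_crossPairs.1 hp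
    exact mem_coe.2 (mem_product.2 ⟨(hF _ he).1, (hF _ hf).1⟩)
  · rintro ⟨e, f⟩ hp ⟨e', f'⟩ hp' heq
    obtain ⟨⟨he, hf⟩, hne, x, h1, h2, h3, h4, h5⟩ := mem_crossPairs.1 hp
    obtain ⟨⟨he', hf'⟩, -, x', h1', h2', h3', h4', h5'⟩ := mem_crossPairs.1 hp'
    obtain ⟨q1, q2⟩ := Prod.mk.inj heq
    dsimp only at *
    have hxx : x = x' := by
      rw [hh e he, hh f hf] at h5
      rw [hh e' he', hh f' hf', ← q1, ← q2] at h5'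
      have hs : (F e).1 ≠ (F f).1 := by
        intro hs
        refine hne (hE.eq_of_overlap hX he hf (fun y => ?_) h1 h2 h3 h4)
        rw [hh e he, hh f hf]
        rw [hs] at h5 ⊢
        linarith
      exact mul_left_cancel₀ (sub_ne_zero.2 hs) (by linarith)
    subst hxx
    refine Prod.ext ?_ ?_
    · exact hE.eq_of_overlap hX he he' (fun y => by rw [hh e he, hh e' he', q1]) h1 h2 h1' h2'
    · exact hE.eq_of_overlap hX hf hf' (fun y => by rw [hh f hf, hh f' hf', q2]) h3 h4 h3' h4'

open Finset in
/-- A form of the Szemerédi–Trotter bound on the number of lines with at least `k` points. -/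
theorem card_rich_lines_mul_le (hX : Function.Injective X) (L : Finset (ℝ × ℝ)) {k : ℕ}
    (hk : 2 ≤ k) (hL : ∀ ℓ ∈ L, k ≤ #(linePts X Y ℓ)) :
    #L * k ^ 3 ≤ 4096 * (Fintype.card α ^ 2 + Fintype.card α * k ^ 2) := by
  classical
  set m := Fintype.card α
  set e := #(L.biUnion (lineEdges X Y)) with he
  have h1 : #L * k ≤ 2 * e := by
    rw [he, sum_card_lineEdges, mul_sum, ← smul_eq_mul, ← sum_const]
    refine sum_le_sum fun ℓ hℓ => ?_
    have := card_linePts_le (Y := Y) hX ℓ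
    have := hL ℓ hℓ
    omega
  have h2 : ∀ s : ℕ, 0 < s → e * s ^ 2 ≤ 4 * m * s ^ 3 + #L ^ 2 := fun s hs =>
    ((isDrawing_biUnion_lineEdges L).card_mul_sq_le hX hs).trans
      (add_le_add le_rfl (card_crossPairs_le hX L))
  rcases le_or_gt e (16 * m) with hem | hem
  · calc #L * k ^ 3 = #L * k * k ^ 2 := by ring
      _ ≤ 2 * (16 * m) * k ^ 2 := Nat.mul_le_mul_right _ (h1.trans (by omega))
      _ ≤ _ := by nlinarith [Nat.zero_le (m * k ^ 2), Nat.zero_le (m ^ 2)]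
  rcases Nat.eq_zero_or_pos #L with hL0 | hL0
  · simp [hL0]
  rcases Nat.eq_zero_or_pos m with hm | hm
  · exfalso
    have : IsEmpty α := Fintype.card_eq_zero_iff.1 hm
    obtain ⟨ℓ, hℓ⟩ := card_pos.1 hL0
    have h3 := hL ℓ hℓ
    rw [eq_empty_of_isEmpty (linePts X Y ℓ)] at h3
    simp at h3
    omega
  set s := e / (8 * m) with hs
  have hs1 : s * (8 * m) ≤ e := Nat.div_mul_le_self _ _
  have hs2 : e < 8 * m * (s + 1) := Nat.lt_mul_div_succ _ (by omega)
  have hs0 : 0 < s := Nat.div_pos (by omega) (by omega)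
  have hs3 : e ≤ 16 * m * s := by nlinarith
  have h3 := h2 s hs0
  have h4 : e * s ^ 2 ≤ 2 * #L ^ 2 := by
    have : 8 * m * s ^ 3 ≤ e * s ^ 2 := by
      calc 8 * m * s ^ 3 = s * (8 * m) * s ^ 2 := by ring
        _ ≤ _ := by gcongr
    nlinarith
  have h5 : e ^ 3 ≤ 512 * m ^ 2 * #L ^ 2 := by
    calc e ^ 3 = e * e ^ 2 := by ring
      _ ≤ e * (16 * m * s) ^ 2 := by gcongr
      _ = 256 * m ^ 2 * (e * s ^ 2) := by ring
      _ ≤ 256 * m ^ 2 * (2 * #L ^ 2) := by gcongr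
      _ = _ := by ring
  have h6 : (#L * k ^ 3) * #L ^ 2 ≤ (4096 * m ^ 2) * #L ^ 2 := by
    calc (#L * k ^ 3) * #L ^ 2 = (#L * k) ^ 3 := by ring
      _ ≤ (2 * e) ^ 3 := by gcongr
      _ = 8 * e ^ 3 := by ring
      _ ≤ 8 * (512 * m ^ 2 * #L ^ 2) := by gcongr
      _ = _ := by ring
  have h7 := Nat.le_of_mul_le_mul_right h6 (by positivity)
  exact h7.trans (by nlinarith [Nat.zero_le (m * k ^ 2)])

open Classical in
/-- Ordered triples of distinct collinear points. -/
noncomputable def colTriples (X Y : α → ℝ) : Finset (α × α × α) :=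
  Finset.univ.filter fun t => t.1 ≠ t.2.1 ∧ t.1 ≠ t.2.2 ∧ t.2.1 ≠ t.2.2 ∧
    ∃ ℓ, t.1 ∈ linePts X Y ℓ ∧ t.2.1 ∈ linePts X Y ℓ ∧ t.2.2 ∈ linePts X Y ℓ

lemma mem_colTriples {t : α × α × α} : t ∈ colTriples X Y ↔
    t.1 ≠ t.2.1 ∧ t.1 ≠ t.2.2 ∧ t.2.1 ≠ t.2.2 ∧
    ∃ ℓ, t.1 ∈ linePts X Y ℓ ∧ t.2.1 ∈ linePts X Y ℓ ∧ t.2.2 ∈ linePts X Y ℓ := by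
  simp [colTriples]

open Finset in
lemma card_colTriples_le (hX : Function.Injective X) {n : ℕ} (hn : Fintype.card α ≤ n)
    (hline : ∀ ℓ, #(linePts X Y ℓ) ^ 2 ≤ n) :
    #(colTriples X Y) ≤ 65536 * (Fintype.card α * n * (Nat.log 2 n + 1)) := by
  classical
  set m := Fintype.card α
  have hl : ∀ t, ∃ ℓ, t ∈ colTriples X Y →
      t.1 ∈ linePts X Y ℓ ∧ t.2.1 ∈ linePts X Y ℓ ∧ t.2.2 ∈ linePts X Y ℓ := by
    intro t
    by_cases ht : t ∈ colTriples X Y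
    · obtain ⟨ℓ, h⟩ := (mem_colTriples.1 ht).2.2.2
      exact ⟨ℓ, fun _ => h⟩
    · exact ⟨0, fun h => absurd h ht⟩
  choose F hF using hl
  set L := (colTriples X Y).image F
  have hL2 : ∀ ℓ ∈ L, 2 ≤ #(linePts X Y ℓ) := by
    intro ℓ hℓ
    obtain ⟨t, ht, rfl⟩ := mem_image.1 hℓ
    rw [← card_pair (mem_colTriples.1 ht).1]
    refine card_le_card fun i hi => ?_
    rcases mem_insert.1 hi with rfl | hi
    · exact (hF t ht).1
    · rw [mem_singleton.1 hi]; exact (hF t ht).2.1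
  have h1 : #(colTriples X Y) ≤ ∑ ℓ ∈ L, #(linePts X Y ℓ) ^ 3 := by
    calc #(colTriples X Y)
        ≤ #(L.biUnion fun ℓ => linePts X Y ℓ ×ˢ linePts X Y ℓ ×ˢ linePts X Y ℓ) := by
          refine card_le_card fun t ht => mem_biUnion.2 ⟨F t, mem_image_of_mem _ ht, ?_⟩
          simp only [mem_product]
          exact hF t ht
      _ ≤ ∑ ℓ ∈ L, #(linePts X Y ℓ ×ˢ linePts X Y ℓ ×ˢ linePts X Y ℓ) := card_biUnion_le
      _ = _ := sum_congr rfl fun ℓ _ => by simp only [card_product]; ring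
  have hlog : ∀ ℓ ∈ L, Nat.log 2 #(linePts X Y ℓ) ∈ range (Nat.log 2 n + 1) := by
    intro ℓ _
    refine mem_range.2 (Nat.lt_succ_of_le (Nat.log_mono_right ?_))
    exact (Nat.le_self_pow two_ne_zero _).trans (hline ℓ)
  refine h1.trans ?_
  rw [← sum_fiberwise_of_maps_to hlog]
  have h2 : ∀ j ∈ range (Nat.log 2 n + 1),
      ∑ ℓ ∈ L with Nat.log 2 #(linePts X Y ℓ) = j, #(linePts X Y ℓ) ^ 3 ≤ 65536 * (m * n) := by
    intro j _
    set Lj := {ℓ ∈ L | Nat.log 2 #(linePts X Y ℓ) = j}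
    rcases Lj.eq_empty_or_nonempty with h0 | ⟨ℓ₀, hℓ₀⟩
    · simp [h0]
    have hlow : ∀ ℓ ∈ Lj, 2 ^ j ≤ #(linePts X Y ℓ) := by
      intro ℓ hℓ
      obtain ⟨hℓL, rfl⟩ := mem_filter.1 hℓ
      exact Nat.pow_log_le_self 2 (by have := hL2 ℓ hℓL; omega)
    have hup : ∀ ℓ ∈ Lj, #(linePts X Y ℓ) ^ 3 ≤ 8 * (2 ^ j) ^ 3 := by
      intro ℓ hℓ
      obtain ⟨hℓ, rfl⟩ := mem_filter.1 hℓ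
      have := (Nat.lt_pow_succ_log_self (b := 2) (by norm_num) #(linePts X Y ℓ)).le
      calc #(linePts X Y ℓ) ^ 3 ≤ (2 ^ (Nat.log 2 #(linePts X Y ℓ)).succ) ^ 3 := by gcongr
        _ = _ := by rw [Nat.succ_eq_add_one, pow_succ 2 (Nat.log 2 _), mul_pow]; ring
    have hj : 2 ≤ 2 ^ j := by
      obtain ⟨hℓ, rfl⟩ := mem_filter.1 hℓ₀
      exact Nat.le_self_pow (Nat.log_pos (by norm_num) (hL2 ℓ₀ hℓ)).ne' 2
    have hkn : (2 ^ j) ^ 2 ≤ n := (Nat.pow_le_pow_left (hlow ℓ₀ hℓ₀) 2).trans (hline ℓ₀)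
    calc ∑ ℓ ∈ Lj, #(linePts X Y ℓ) ^ 3 ≤ ∑ ℓ ∈ Lj, 8 * (2 ^ j) ^ 3 := sum_le_sum hup
      _ = 8 * (#Lj * (2 ^ j) ^ 3) := by rw [sum_const, smul_eq_mul]; ring
      _ ≤ 8 * (4096 * (m ^ 2 + m * (2 ^ j) ^ 2)) :=
          Nat.mul_le_mul_left 8 (card_rich_lines_mul_le hX Lj hj hlow)
      _ ≤ 8 * (4096 * (m * n + m * n)) := by rw [sq m]; gcongr
      _ = _ := by ring
  refine (sum_le_sum h2).trans ?_
  rw [sum_const, card_range, smul_eq_mul]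
  exact le_of_eq (by ring)

open Finset in
/-- If `K` is large, some `K`-colouring leaves at most half of the points in monochromatic
collinear triples. -/
lemma exists_colouring_half (hX : Function.Injective X) {n K : ℕ} (hn : Fintype.card α ≤ n)
    (hline : ∀ ℓ, #(linePts X Y ℓ) ^ 2 ≤ n) (hK0 : 0 < K)
    (hK : 131072 * (n * (Nat.log 2 n + 1)) ≤ K ^ 2) :
    ∃ (f : α → Fin K) (B : Finset α), 2 * #B ≤ Fintype.card α ∧
      ∀ t ∈ colTriples X Y, f t.1 = f t.2.1 → f t.1 = f t.2.2 → t.1 ∈ B := by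
  classical
  set m := Fintype.card α
  let M : (α → Fin K) → Finset (α × α × α) := fun f =>
    {t ∈ colTriples X Y | f t.1 = f t.2.1 ∧ f t.1 = f t.2.2}
  have hM : ∀ f, #(M f) = ∑ c : Fin K,
      #{t ∈ colTriples X Y | ∀ a ∈ ({t.1, t.2.1, t.2.2} : Finset α), f a = c} := by
    intro f
    rw [card_eq_sum_card_fiberwise (f := fun t => f t.1) (t := univ) (fun _ _ => by simp)]
    refine sum_congr rfl fun c _ => congrArg _ ?_
    ext t
    simp only [M, mem_filter, mem_insert, mem_singleton, forall_eq_or_imp, forall_eq]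
    constructor
    · rintro ⟨⟨h, h1, h2⟩, h3⟩
      exact ⟨h, h3, h1 ▸ h3, h2 ▸ h3⟩
    · rintro ⟨h, h1, h2, h3⟩
      exact ⟨⟨h, h1.trans h2.symm, h1.trans h3.symm⟩, h1⟩
  have hsum : (∑ f, #(M f)) * K ^ 2 = #(colTriples X Y) * K ^ m := by
    refine Nat.eq_of_mul_eq_mul_right hK0 ?_
    rw [mul_assoc, ← pow_succ]
    simp only [hM]
    rw [sum_comm, sum_mul, sum_congr rfl fun c _ => sum_card_filter_const_mul (s := 3)
      (colTriples X Y) (fun t => {t.1, t.2.1, t.2.2}) (fun t ht => by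
        obtain ⟨h1, h2, h3, -⟩ := mem_colTriples.1 ht
        exact card_eq_three.2 ⟨_, _, _, h1, h2, h3, rfl⟩) c]
    rw [sum_const, card_univ, Fintype.card_fin, smul_eq_mul]
    ring
  obtain ⟨f, hf⟩ : ∃ f, 2 * #(M f) ≤ m := by
    by_contra! hall
    have h1 : K ^ m * (m + 1) ≤ 2 * ∑ f, #(M f) := by
      have : ∑ _f : α → Fin K, (m + 1) ≤ ∑ f, 2 * #(M f) := sum_le_sum fun f _ => hall f
      rw [sum_const, card_univ, Fintype.card_fun, Fintype.card_fin, smul_eq_mul,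
        ← mul_sum] at this
      exact this
    have h2 : 2 * #(colTriples X Y) ≤ m * K ^ 2 := by
      calc 2 * #(colTriples X Y) ≤ 2 * (65536 * (m * n * (Nat.log 2 n + 1))) := by
            gcongr; exact card_colTriples_le hX hn hline
        _ = m * (131072 * (n * (Nat.log 2 n + 1))) := by ring
        _ ≤ _ := by gcongr
    have h3 : (m + 1) * (K ^ m * K ^ 2) ≤ m * (K ^ m * K ^ 2) := by
      calc (m + 1) * (K ^ m * K ^ 2) = K ^ m * (m + 1) * K ^ 2 := by ring
        _ ≤ (2 * ∑ f, #(M f)) * K ^ 2 := by gcongr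
        _ = 2 * #(colTriples X Y) * K ^ m := by rw [mul_assoc, hsum, mul_assoc]
        _ ≤ m * K ^ 2 * K ^ m := by gcongr
        _ = _ := by ring
    have := Nat.le_of_mul_le_mul_right h3 (by positivity)
    omega
  refine ⟨f, (M f).image Prod.fst, ?_, fun t ht h1 h2 => ?_⟩
  · have : #((M f).image Prod.fst) ≤ #(M f) := card_image_le
    omega
  · exact mem_image_of_mem _ (mem_filter.2 ⟨ht, h1, h2⟩)

end Lines

open Finset in
/-- Repeated halving: few colours suffice to destroy all monochromatic collinear triples. -/
lemma exists_colouring_of_card_lt {β : Type*} {X Y : β → ℝ} {P : Finset β}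
    (hX : Set.InjOn X P) {n K : ℕ} (hn : #P ≤ n)
    (hline : ∀ a b : ℝ, #{p ∈ P | Y p = a * X p + b} ^ 2 ≤ n) (hK0 : 0 < K)
    (hK : 131072 * (n * (Nat.log 2 n + 1)) ≤ K ^ 2) (j : ℕ) :
    ∀ Q ⊆ P, #Q < 2 ^ j → ∃ χ : β → ℕ, (∀ p ∈ Q, χ p < j * K) ∧
      ∀ p ∈ Q, ∀ q ∈ Q, ∀ r ∈ Q, p ≠ q → p ≠ r → q ≠ r → χ p = χ q → χ p = χ r →
        ∀ a b : ℝ, Y p = a * X p + b → Y q = a * X q + b → Y r ≠ a * X r + b := by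
  classical
  induction j with
  | zero =>
    intro Q _ hQ
    have : Q = ∅ := card_eq_zero.1 (by simpa using hQ)
    subst this
    exact ⟨fun _ => 0, by simp, by simp⟩
  | succ j ih =>
    intro Q hQP hQ
    have hXQ : Function.Injective fun p : Q => X p := fun p q h =>
      Subtype.ext (hX (hQP p.2) (hQP q.2) h)
    obtain ⟨f, B, hB, hf⟩ := exists_colouring_half (Y := fun p : Q => Y p) hXQ (n := n) (K := K)
      (by rw [Fintype.card_coe]; exact (card_le_card hQP).trans hn) (fun ℓ => by
        refine le_trans (Nat.pow_le_pow_left ?_ 2) (hline ℓ.1 ℓ.2)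
        rw [← card_map (Function.Embedding.subtype _)]
        refine card_le_card fun p hp => ?_
        obtain ⟨q, hq, rfl⟩ := mem_map.1 hp
        have hq' := (mem_linePts (X := fun p : Q => X p) (Y := fun p : Q => Y p)).1 hq
        exact mem_filter.2 ⟨hQP q.2, hq'⟩) hK0 hK
    rw [Fintype.card_coe] at hB
    have hQ' : B.map (Function.Embedding.subtype _) ⊆ Q := by
      intro p hp
      obtain ⟨q, -, rfl⟩ := mem_map.1 hp
      exact q.2
    obtain ⟨χ, h1, h2⟩ := ih (B.map (Function.Embedding.subtype _)) (hQ'.trans hQP)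
      (by rw [card_map]; rw [pow_succ] at hQ; omega)
    set Q' := B.map (Function.Embedding.subtype _)
    let χ' : β → ℕ := fun p => if p ∈ Q' then χ p else if h : p ∈ Q then j * K + f ⟨p, h⟩ else 0
    have hin : ∀ p ∈ Q', χ' p = χ p := fun p hp => if_pos hp
    have hout : ∀ p ∉ Q', ∀ h : p ∈ Q, χ' p = j * K + f ⟨p, h⟩ := fun p hp h => by
      simp only [χ', if_neg hp, dif_pos h]
    refine ⟨χ', fun p hp => ?_, fun p hp q hq r hr hpq hpr hqr e1 e2 a b l1 l2 l3 => ?_⟩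
    · rw [add_mul, one_mul]
      by_cases hp' : p ∈ Q'
      · rw [hin p hp']; exact (h1 p hp').trans_le (Nat.le_add_right _ _)
      · rw [hout p hp' hp]; exact Nat.add_lt_add_left (f _).2 _
    · by_cases hp' : p ∈ Q'
      · have hlt := h1 p hp'
        have key : ∀ s ∈ Q, χ' p = χ' s → s ∈ Q' := fun s hs he => by
          by_contra hs'
          rw [hin p hp', hout s hs' hs] at he
          omega
        have hq' := key q hq e1
        have hr' := key r hr e2
        rw [hin p hp', hin q hq'] at e1
        rw [hin p hp', hin r hr'] at e2
        exact h2 p hp' q hq' r hr' hpq hpr hqr e1 e2 a b l1 l2 l3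
      · have key : ∀ s (hs : s ∈ Q), χ' p = χ' s → f ⟨p, hp⟩ = f ⟨s, hs⟩ := fun s hs he => by
          by_cases hs' : s ∈ Q'
          · have := h1 s hs'
            rw [hout p hp' hp, hin s hs'] at he
            omega
          · rw [hout p hp' hp, hout s hs' hs] at he
            exact Fin.ext (Nat.add_left_cancel he)
        refine hp' (mem_map.2 ⟨⟨p, hp⟩, hf (⟨p, hp⟩, ⟨q, hq⟩, ⟨r, hr⟩)
          (mem_colTriples.2 ⟨?_, ?_, ?_, (a, b), ?_, ?_, ?_⟩) (key q hq e1) (key r hr e2), rfl⟩)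
        · exact fun h => hpq (congrArg Subtype.val h)
        · exact fun h => hpr (congrArg Subtype.val h)
        · exact fun h => hqr (congrArg Subtype.val h)
        · exact mem_linePts.2 l1
        · exact mem_linePts.2 l2
        · exact mem_linePts.2 l3

/-- A shear makes the first coordinates of finitely many points distinct. -/
lemma exists_shear_injOn (P : Finset (ℝ × ℝ)) :
    ∃ t : ℝ, Set.InjOn (fun p : ℝ × ℝ => p.1 + t * p.2) P := by
  classical
  obtain ⟨t, ht⟩ := Infinite.exists_notMem_finset
    ((P ×ˢ P).image fun pq => -(pq.1.1 - pq.2.1) / (pq.1.2 - pq.2.2))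
  refine ⟨t, fun p hp q hq h => ?_⟩
  dsimp only at h
  by_cases h2 : p.2 = q.2
  · rw [h2] at h
    exact Prod.ext (by linarith) h2
  · refine absurd (Finset.mem_image.2 ⟨(p, q), Finset.mem_product.2 ⟨hp, hq⟩, ?_⟩) ht
    rw [div_eq_iff (sub_ne_zero.2 h2)]
    dsimp only
    linarith

lemma collinear_of_forall_shear_line {S : Set (ℝ × ℝ)} {t a b : ℝ}
    (h : ∀ p ∈ S, p.2 = a * (p.1 + t * p.2) + b) : Collinear ℝ S := by
  rw [collinear_iff_exists_forall_eq_smul_vadd]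
  refine ⟨(-(t * b), b), (1 - t * a, a), fun p hp => ⟨p.1 + t * p.2, ?_⟩⟩
  have := h p hp
  ext
  · simp only [vadd_eq_add, Prod.fst_add, Prod.smul_fst, smul_eq_mul]
    linear_combination t * (-this)
  · simp only [vadd_eq_add, Prod.snd_add, Prod.smul_snd, smul_eq_mul]
    linear_combination this

lemma exists_shear_line_of_collinear {S : Set (ℝ × ℝ)} {t : ℝ} (hS : Collinear ℝ S)
    {p q : ℝ × ℝ} (hp : p ∈ S) (hq : q ∈ S) (hpq : p.1 + t * p.2 ≠ q.1 + t * q.2) :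
    ∃ a b : ℝ, ∀ r ∈ S, r.2 = a * (r.1 + t * r.2) + b := by
  obtain ⟨v, hv⟩ := (collinear_iff_of_mem hp).1 hS
  have hd : v.1 + t * v.2 ≠ 0 := by
    intro h0
    obtain ⟨s, hs⟩ := hv q hq
    apply hpq
    simp only [hs, vadd_eq_add, Prod.fst_add, Prod.snd_add, Prod.smul_fst, Prod.smul_snd,
      smul_eq_mul]
    linear_combination (-s) * h0
  refine ⟨v.2 / (v.1 + t * v.2), p.2 - v.2 / (v.1 + t * v.2) * (p.1 + t * p.2), fun r hr => ?_⟩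
  obtain ⟨s, hs⟩ := hv r hr
  simp only [hs, vadd_eq_add, Prod.fst_add, Prod.snd_add, Prod.smul_fst, Prod.smul_snd,
    smul_eq_mul]
  have := div_mul_cancel₀ v.2 hd
  linear_combination (-s) * this

/-- The number of colours used by repeated halving. -/
lemma log_mul_sqrt_le {n : ℕ} (hn : 2 ≤ n) :
    (((Nat.log 2 n + 1) * (Nat.sqrt (131072 * (n * (Nat.log 2 n + 1))) + 1) : ℕ) : ℝ) ≤
      6400 * Real.sqrt n * Real.log n ^ ((3 : ℝ) / 2) := by
  set M := Nat.log 2 n + 1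
  have hn0 : (2 : ℝ) ≤ n := by exact_mod_cast hn
  have hl2 := Real.log_two_gt_d9
  have hln : Real.log 2 ≤ Real.log n := Real.log_le_log (by norm_num) hn0
  have hl0 : 0 < Real.log n := by linarith
  have hM : (M : ℝ) ≤ 4 * Real.log n := by
    have h1 : ((2 ^ Nat.log 2 n : ℕ) : ℝ) ≤ n := by
      exact_mod_cast Nat.pow_log_le_self 2 (by omega)
    have h2 := Real.log_le_log (by positivity) h1
    rw [Nat.cast_pow, Real.log_pow] at h2
    have hM1 : (M : ℝ) = Nat.log 2 n + 1 := by simp [M]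
    push_cast at h2
    have h3 : (0 : ℝ) ≤ Nat.log 2 n := Nat.cast_nonneg _
    nlinarith
  have hK : ((Nat.sqrt (131072 * (n * M)) + 1 : ℕ) : ℝ) ≤
      1600 * (Real.sqrt n * Real.sqrt (Real.log n)) := by
    have h1 : 1 ≤ Nat.sqrt (131072 * (n * M)) := by
      rw [Nat.le_sqrt]
      have : 0 < n * M := by positivity
      omega
    have h2 : ((Nat.sqrt (131072 * (n * M)) : ℕ) : ℝ) ≤
        800 * (Real.sqrt n * Real.sqrt (Real.log n)) := by
      rw [← Real.sqrt_mul (by positivity)]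
      refine (sq_le_sq₀ (by positivity) (by positivity)).1 ?_
      rw [mul_pow, Real.sq_sqrt (by positivity)]
      have h3 : ((Nat.sqrt (131072 * (n * M)) ^ 2 : ℕ) : ℝ) ≤ (131072 * (n * M) : ℕ) := by
        exact_mod_cast Nat.sqrt_le' _
      push_cast at h3
      nlinarith
    have h1' : (1 : ℝ) ≤ (Nat.sqrt (131072 * (n * M)) : ℕ) := by exact_mod_cast h1
    push_cast
    linarith
  have hpow : Real.log n ^ ((3 : ℝ) / 2) = Real.log n * Real.sqrt (Real.log n) := by
    rw [Real.sqrt_eq_rpow, ← Real.rpow_one_add' hl0.le (by norm_num)]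
    norm_num
  rw [hpow, Nat.cast_mul]
  calc (M : ℝ) * ((Nat.sqrt (131072 * (n * M)) + 1 : ℕ) : ℝ)
      ≤ (4 * Real.log n) * (1600 * (Real.sqrt n * Real.sqrt (Real.log n))) := by gcongr
    _ = _ := by ring

/-- There is `c > 0` such that every set `P` of `n ≥ 2` points in the plane with at most
`√n` collinear can be partitioned into at most `c·√n·(log n)^(3/2)` parts, each in
general position. The partition is given by a colouring `χ` of the points with colours
`< N` whose colour classes are each in general position. -/
theorem colouring_sqrt_n_polylog :
    ∃ c : ℝ, 0 < c ∧
      ∀ (n : ℕ) (P : Finset (ℝ × ℝ)),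
        2 ≤ n → P.card = n →
        (∀ T ⊆ P, Collinear ℝ (T : Set (ℝ × ℝ)) → (T.card : ℝ) ≤ Real.sqrt n) →
        ∃ N : ℕ, (N : ℝ) ≤ c * Real.sqrt n * Real.log n ^ ((3 : ℝ) / 2) ∧
          ∃ χ : ℝ × ℝ → ℕ,
            (∀ p ∈ P, χ p < N) ∧
            ∀ i : ℕ, GeneralPosition (P.filter (fun p => χ p = i)) := by
  refine ⟨6400, by norm_num, fun n P hn hP hcol => ?_⟩
  obtain ⟨t, ht⟩ := exists_shear_injOn P
  obtain ⟨χ, h1, h2⟩ := exists_colouring_of_card_lt (X := fun p : ℝ × ℝ => p.1 + t * p.2)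
    (Y := Prod.snd) ht hP.le (fun a b => by
      have := hcol (P.filter fun p => p.2 = a * (p.1 + t * p.2) + b) (Finset.filter_subset _ _)
        (collinear_of_forall_shear_line fun p hp => (Finset.mem_filter.1 hp).2)
      exact_mod_cast (Real.le_sqrt (Nat.cast_nonneg _) (Nat.cast_nonneg _)).1 this)
    (Nat.succ_pos (Nat.sqrt (131072 * (n * (Nat.log 2 n + 1))))) (Nat.lt_succ_sqrt' _).le
    (Nat.log 2 n + 1) P subset_rfl (by
      rw [hP]; exact Nat.lt_pow_succ_log_self (by norm_num) n)
  refine ⟨_, log_mul_sqrt_le hn, χ, h1, fun i T hT hTc => ?_⟩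
  by_contra! hcard
  obtain ⟨p, q, r, hp, hq, hr, hpq, hpr, hqr⟩ := Finset.two_lt_card_iff.1 hcard
  obtain ⟨hpP, hpi⟩ := Finset.mem_filter.1 (hT hp)
  obtain ⟨hqP, hqi⟩ := Finset.mem_filter.1 (hT hq)
  obtain ⟨hrP, hri⟩ := Finset.mem_filter.1 (hT hr)
  obtain ⟨a, b, hab⟩ := exists_shear_line_of_collinear (t := t) hTc hp hq
    fun h => hpq (ht hpP hqP h)
  exact h2 p hpP q hqP r hrP hpq hpr hqr (hpi.trans hqi.symm) (hpi.trans hri.symm) a b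
    (hab p hp) (hab q hq) (hab r hr)
end

section
/- There exists a constant c > 0 such that the following holds. Let ℓ ≥ 3 be an integer and let P be a set of n points in the plane ℝ² with at most ℓ collinear. Then P can be partitioned into at most c·√(ℓ·n) parts such that each part is in general position. -/
/-- A finite point set has "at most ℓ collinear" if every collinear subset has ≤ ℓ points. -/
def AtMostCollinear (P : Finset (ℝ × ℝ)) (ℓ : ℕ) : Prop :=
  ∀ T ⊆ P, Collinear ℝ (T : Set (ℝ × ℝ)) → T.card ≤ ℓ

open Finset in
/-- The `k`-colourings of `V` with no monochromatic edge of `H` inside `S`. -/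
noncomputable def colouringsProperOn {V : Type*} [Fintype V] (H : Finset (Finset V)) (k : ℕ)
    (S : Finset V) : Finset (V → Fin k) := by
  classical
  exact univ.filter fun f => ∀ e ∈ H, e ⊆ S → ¬ ∀ x ∈ e, ∀ y ∈ e, f x = f y

section Hypergraph

open Finset

variable {V : Type*} [Fintype V] {H : Finset (Finset V)} {k : ℕ}

theorem mem_colouringsProperOn {S : Finset V} {f : V → Fin k} :
    f ∈ colouringsProperOn H k S ↔ ∀ e ∈ H, e ⊆ S → ¬ ∀ x ∈ e, ∀ y ∈ e, f x = f y := by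
  simp [colouringsProperOn]

theorem mem_colouringsProperOn_congr {S : Finset V} {f g : V → Fin k}
    (hfg : ∀ x ∈ S, f x = g x) (hf : f ∈ colouringsProperOn H k S) :
    g ∈ colouringsProperOn H k S := by
  rw [mem_colouringsProperOn] at hf ⊢
  intro e he heS hmono
  refine hf e he heS fun x hx y hy => ?_
  rw [hfg x (heS hx), hfg y (heS hy), hmono x hx y hy]

/-- Two vertices outside `S` can be recoloured freely, so few colourings that are proper on `S`
give both of them the colour of a third vertex. -/
theorem card_filter_eq_mul_sq_le [DecidableEq V] {S : Finset V} {v x y : V}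
    (hv : v ∉ S) (hx : x ∉ S) (hvx : v ≠ x) (hvy : v ≠ y) (hxy : x ≠ y) :
    #{f ∈ colouringsProperOn H k S | f v = f y ∧ f x = f y} * k ^ 2 ≤
      #(colouringsProperOn H k S) := by
  have hcard : #({f ∈ colouringsProperOn H k S | f v = f y ∧ f x = f y} ×ˢ
      (univ : Finset (Fin k × Fin k))) =
      #{f ∈ colouringsProperOn H k S | f v = f y ∧ f x = f y} * k ^ 2 := by
    simp [card_product, sq]
  rw [← hcard]
  refine card_le_card_of_injOn
    (fun p => Function.update (Function.update p.1 v p.2.1) x p.2.2) ?_ ?_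
  · rintro ⟨f, a, b⟩ hf
    simp only [coe_product, Set.mem_prod, mem_coe, mem_filter] at hf
    refine mem_colouringsProperOn_congr (fun z hz => ?_) hf.1.1
    have h₁ : z ≠ v := fun h => hv (h ▸ hz)
    have h₂ : z ≠ x := fun h => hx (h ▸ hz)
    simp [h₁, h₂]
  · rintro ⟨f, a, b⟩ hf ⟨g, c, d⟩ hg h
    simp only [coe_product, Set.mem_prod, mem_coe, mem_filter] at hf hg
    have key := fun z => congrFun h z
    have hy : f y = g y := by simpa [hvy.symm, hxy.symm] using key y
    have hb : b = d := by simpa using key x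
    have ha : a = c := by simpa [hvx] using key v
    have hfg : f = g := by
      funext z
      by_cases hzv : z = v
      · rw [hzv, hf.1.2.1, hg.1.2.1, hy]
      by_cases hzx : z = x
      · rw [hzx, hf.1.2.2, hg.1.2.2, hy]
      simpa [hzv, hzx] using key z
    rw [hfg, ha, hb]

/-- Adding a vertex to `S` at most halves the number of `2b`-colourings proper on `S`, when the
hypergraph is `3`-uniform with maximum degree at most `b ^ 2`. -/
theorem card_colouringsProperOn_le_two_mul [DecidableEq V] {b : ℕ} (hb : 0 < b)
    (hH : ∀ e ∈ H, #e = 3) (hdeg : ∀ v, #{e ∈ H | v ∈ e} ≤ b ^ 2)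
    (S : Finset V) (v : V) (hv : v ∉ S) :
    #(colouringsProperOn H (2 * b) S) ≤ 2 * #(colouringsProperOn H (2 * b) (insert v S)) := by
  induction hn : #S using Nat.strong_induction_on generalizing S v with
  | _ n ih =>
  subst hn
  set N := colouringsProperOn H (2 * b) with hN
  let bad : Finset V → Finset (V → Fin (2 * b)) :=
    fun e => {f ∈ N S | ∀ x ∈ e, ∀ y ∈ e, f x = f y}
  let I := {e ∈ {e ∈ H | v ∈ e} | e ⊆ insert v S}
  have hcover : N S ⊆ N (insert v S) ∪ I.biUnion bad := by
    intro f hf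
    by_contra hcon
    simp only [mem_union, mem_biUnion, not_or, not_exists, not_and] at hcon
    refine hcon.1 (mem_colouringsProperOn.2 fun e he heS hmono => ?_)
    by_cases hve : v ∈ e
    · exact hcon.2 e (by simp [I, he, hve, heS]) (by simp only [bad, mem_filter]; exact ⟨hf, hmono⟩)
    · exact mem_colouringsProperOn.1 hf e he ((subset_insert_iff_of_notMem hve).1 heS) hmono
  have hbad : ∀ e ∈ I, #(bad e) * (2 * b) ^ 2 ≤ 2 * #(N S) := by
    intro e he
    simp only [I, mem_filter] at he
    obtain ⟨⟨heH, hve⟩, heS⟩ := he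
    have hcard : #(e.erase v) = 2 := by rw [card_erase_of_mem hve, hH e heH]
    obtain ⟨x, y, hxy, hexy⟩ := card_eq_two.1 hcard
    have hxe : x ∈ e.erase v := by simp [hexy]
    have hye : y ∈ e.erase v := by simp [hexy]
    rw [mem_erase] at hxe hye
    have hxS : x ∈ S := (mem_insert.1 (heS hxe.2)).resolve_left hxe.1
    have hstep := ih _ (card_erase_lt_of_mem hxS) (S.erase x) x (notMem_erase x S) rfl
    rw [insert_erase hxS] at hstep
    refine le_trans ?_ hstep
    refine le_trans (Nat.mul_le_mul_right _ (card_le_card ?_))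
      (card_filter_eq_mul_sq_le (S := S.erase x) (fun h => hv (mem_of_mem_erase h))
        (notMem_erase x S) hxe.1.symm hye.1.symm hxy)
    intro f hf
    simp only [bad, mem_filter] at hf
    refine mem_filter.2 ⟨mem_colouringsProperOn.2 fun e' he' hs => ?_,
      hf.2 v hve y hye.2, hf.2 x hxe.2 y hye.2⟩
    exact mem_colouringsProperOn.1 hf.1 e' he' (hs.trans (erase_subset x S))
  have hI : #I ≤ b ^ 2 := (card_le_card (filter_subset _ _)).trans (hdeg v)
  have hsum : #(I.biUnion bad) * (2 * b) ^ 2 ≤ b ^ 2 * (2 * #(N S)) :=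
    calc #(I.biUnion bad) * (2 * b) ^ 2
        ≤ (∑ e ∈ I, #(bad e)) * (2 * b) ^ 2 := Nat.mul_le_mul_right _ card_biUnion_le
      _ = ∑ e ∈ I, #(bad e) * (2 * b) ^ 2 := sum_mul _ _ _
      _ ≤ #I * (2 * #(N S)) := by simpa using sum_le_card_nsmul I _ _ hbad
      _ ≤ b ^ 2 * (2 * #(N S)) := Nat.mul_le_mul_right _ hI
  have hhalf : 2 * #(I.biUnion bad) ≤ #(N S) := by
    have hpos : 0 < 2 * b ^ 2 := by positivity
    refine Nat.le_of_mul_le_mul_left ?_ hpos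
    linarith
  have := (card_le_card hcover).trans (card_union_le _ _)
  omega

/-- A `3`-uniform hypergraph with maximum degree at most `b ^ 2` is `2b`-colourable. -/
theorem exists_colouring_of_degree_le_sq [DecidableEq V] {b : ℕ} (hb : 0 < b)
    (hH : ∀ e ∈ H, #e = 3) (hdeg : ∀ v, #{e ∈ H | v ∈ e} ≤ b ^ 2) :
    ∃ f : V → Fin (2 * b), ∀ e ∈ H, ¬ ∀ x ∈ e, ∀ y ∈ e, f x = f y := by
  have hpos : ∀ S : Finset V, 0 < #(colouringsProperOn H (2 * b) S) := by
    intro S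
    induction S using Finset.induction_on with
    | empty =>
      refine card_pos.2 ⟨fun _ => ⟨0, by omega⟩, mem_colouringsProperOn.2 fun e he hs => ?_⟩
      have := hH e he
      simp [subset_empty.1 hs] at this
    | insert v S hv ih =>
      have := card_colouringsProperOn_le_two_mul hb hH hdeg S v hv
      omega
  obtain ⟨f, hf⟩ := card_pos.1 (hpos univ)
  exact ⟨f, fun e he => mem_colouringsProperOn.1 hf e he (subset_univ e)⟩

end Hypergraph

open Finset in
/-- Each point of `P` lies in at most `n * ℓ` collinear triples of `P`. -/
theorem card_collinear_triples_le {P : Finset (ℝ × ℝ)} {ℓ : ℕ} (hP : AtMostCollinear P ℓ)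
    (H : Finset (Finset P))
    (hH : ∀ e ∈ H, #e = 3 ∧ Collinear ℝ (Subtype.val '' (e : Set P))) (v : P) :
    #{e ∈ H | v ∈ e} ≤ #P * ℓ := by
  classical
  let L : P → Finset P := fun x => {y | v ≠ x ∧ (y : ℝ × ℝ) ∈ line[ℝ, (v : ℝ × ℝ), (x : ℝ × ℝ)]}
  have hL : ∀ x, #(L x) ≤ ℓ := by
    intro x
    rw [← card_map (Function.Embedding.subtype _)]
    refine hP _ (fun p hp => ?_) ?_
    · obtain ⟨q, -, rfl⟩ := mem_map.1 hp
      exact q.2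
    · refine (collinear_iff_exists_forall_eq_smul_vadd _).2
        ⟨v, (x : ℝ × ℝ) - v, fun p hp => ?_⟩
      obtain ⟨q, hq, rfl⟩ := mem_map.1 (mem_coe.1 hp)
      simp only [L, mem_filter] at hq
      obtain ⟨r, hr⟩ := mem_affineSpan_pair_iff_exists_lineMap_eq.1 hq.2.2
      exact ⟨r, by rw [Function.Embedding.subtype_apply, ← hr, AffineMap.lineMap_apply]; rfl⟩
  have hsub : {e ∈ H | v ∈ e} ⊆
      (univ : Finset P).biUnion fun x => (L x).image fun y => {v, x, y} := by
    intro e he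
    obtain ⟨heH, hve⟩ := mem_filter.1 he
    obtain ⟨hcard, hcol⟩ := hH e heH
    have hcard' : #(e.erase v) = 2 := by rw [card_erase_of_mem hve, hcard]
    obtain ⟨x, y, hxy, hexy⟩ := card_eq_two.1 hcard'
    have hxe : x ∈ e.erase v := by simp [hexy]
    have hye : y ∈ e.erase v := by simp [hexy]
    rw [mem_erase] at hxe hye
    refine mem_biUnion.2 ⟨x, mem_univ x, mem_image.2 ⟨y, ?_, ?_⟩⟩
    · refine mem_filter.2 ⟨mem_univ y, hxe.1.symm, ?_⟩
      exact hcol.mem_affineSpan_of_mem_of_ne (Set.mem_image_of_mem _ hve)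
        (Set.mem_image_of_mem _ hxe.2) (Set.mem_image_of_mem _ hye.2)
        (fun h => hxe.1 (Subtype.ext h).symm)
    · rw [← hexy, insert_erase hve]
  calc #{e ∈ H | v ∈ e} ≤ _ := card_le_card hsub
    _ ≤ #(univ : Finset P) * ℓ :=
      card_biUnion_le_card_mul _ _ _ fun x _ => card_image_le.trans (hL x)
    _ = #P * ℓ := by simp

/-- There is `c > 0` such that every set of `n` points in the plane with at most `ℓ`
collinear (`ℓ ≥ 3`) can be partitioned into at most `c·√(ℓ·n)` parts, each in general
position. The partition is given by a colouring `χ` with colours `< N`. -/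
theorem colouring_sqrt_ln :
    ∃ c : ℝ, 0 < c ∧
      ∀ (ℓ n : ℕ) (P : Finset (ℝ × ℝ)),
        3 ≤ ℓ → P.card = n → AtMostCollinear P ℓ →
        ∃ N : ℕ, (N : ℝ) ≤ c * Real.sqrt ((ℓ : ℝ) * n) ∧
          ∃ χ : ℝ × ℝ → ℕ,
            (∀ p ∈ P, χ p < N) ∧
            ∀ i : ℕ, GeneralPosition (P.filter (fun p => χ p = i)) := by
  classical
  refine ⟨4, by norm_num, fun ℓ n P hℓ hn hP => ?_⟩
  rcases Nat.eq_zero_or_pos n with rfl | hnpos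
  · obtain rfl := Finset.card_eq_zero.1 hn
    refine ⟨0, by simp, fun _ => 0, by simp, fun i T hT _ => ?_⟩
    simp [show T = ∅ by simpa using hT]
  have hone : (1 : ℝ) ≤ Real.sqrt ((ℓ : ℝ) * n) := by
    rw [Real.one_le_sqrt]
    exact_mod_cast Nat.mul_pos (by omega) hnpos
  set b := ⌈Real.sqrt ((ℓ : ℝ) * n)⌉₊ with hbdef
  have hb : 0 < b := Nat.ceil_pos.2 (by linarith)
  have hle : n * ℓ ≤ b ^ 2 := by
    have h := (Real.sqrt_le_left (Nat.cast_nonneg b)).1 (Nat.le_ceil (Real.sqrt ((ℓ : ℝ) * n)))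
    rw [mul_comm]
    exact_mod_cast h
  let H : Finset (Finset P) :=
    Finset.univ.filter fun e => e.card = 3 ∧ Collinear ℝ (Subtype.val '' (e : Set P))
  have hH : ∀ e ∈ H, e.card = 3 ∧ Collinear ℝ (Subtype.val '' (e : Set P)) :=
    fun e he => (Finset.mem_filter.1 he).2
  obtain ⟨f, hf⟩ := exists_colouring_of_degree_le_sq hb (fun e he => (hH e he).1)
    fun v => (card_collinear_triples_le hP H hH v).trans (hn ▸ hle)
  refine ⟨2 * b, ?_, fun p => if h : p ∈ P then f ⟨p, h⟩ else 0, fun p hp => ?_, fun i => ?_⟩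
  · have := (Nat.ceil_lt_add_one (Real.sqrt_nonneg ((ℓ : ℝ) * n))).le
    push_cast
    linarith
  · simp [hp]
  · intro T hT hcol
    by_contra! hcard
    obtain ⟨U, hUT, hU⟩ := Finset.exists_subset_card_eq (show 3 ≤ T.card from hcard)
    have hUP : ∀ p ∈ U, p ∈ P := fun p hp => (Finset.mem_filter.1 (hT (hUT hp))).1
    have hUi : ∀ p : P, (p : ℝ × ℝ) ∈ U → (f p : ℕ) = i := fun p hp => by
      simpa using (Finset.mem_filter.1 (hT (hUT hp))).2
    refine hf (U.subtype (· ∈ P)) (Finset.mem_filter.2 ⟨Finset.mem_univ _, ?_, ?_⟩) ?_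
    · rw [Finset.card_subtype, Finset.filter_true_of_mem hUP, hU]
    · refine hcol.subset ?_
      rintro _ ⟨p, hp, rfl⟩
      exact hUT (Finset.mem_subtype.1 hp)
    · intro x hx y hy
      apply Fin.ext
      rw [hUi x (Finset.mem_subtype.1 hx), hUi y (Finset.mem_subtype.1 hy)]
end

section
/- Let ℓ ≥ 1 and d ≥ 1 be integers, and let a, b, c be three pairwise distinct collinear points of ℝ^d, each of whose coordinates lies in {1, 2, …, ℓ}. Then a, b, c do not all have the same signature; that is, there exists a value v ∈ {1, …, ℓ} such that the number of coordinates equal to v is not the same for a, b and c. -/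
open scoped Classical

/-- The signature of a point `x ∈ ℝ^d`: the number of coordinates of `x` equal to `v`. -/
noncomputable def signature {d : ℕ} (x : Fin d → ℝ) (v : ℕ) : ℕ :=
  (Finset.univ.filter (fun i => x i = (v : ℝ))).card

/-- The sum of squares of the coordinates of a point of `{1,…,ℓ}^d` is determined by its
signature. -/
theorem sum_sq_eq_sum_signature {ℓ d : ℕ} {x : Fin d → ℝ}
    (hx : ∀ i, ∃ j ∈ Finset.Icc 1 ℓ, x i = (j : ℝ)) :
    ∑ i, x i ^ 2 = ∑ v ∈ Finset.Icc 1 ℓ, (signature x v : ℝ) * (v : ℝ) ^ 2 := by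
  have coord_sq : ∀ i, x i ^ 2 =
      ∑ v ∈ Finset.Icc 1 ℓ, if x i = (v : ℝ) then (v : ℝ) ^ 2 else 0 := by
    intro i
    obtain ⟨j, hj, hij⟩ := hx i
    simp only [hij, Nat.cast_inj, Finset.sum_ite_eq, if_pos hj]
  rw [Finset.sum_congr rfl fun i _ => coord_sq i, Finset.sum_comm]
  refine Finset.sum_congr rfl fun v _ => ?_
  rw [← Finset.sum_filter, Finset.sum_const, nsmul_eq_mul, signature]

/-- Three pairwise distinct points on a sphere centred at the origin are not collinear. -/
theorem not_collinear_of_sum_sq_eq {d : ℕ} {a b c : Fin d → ℝ}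
    (hab : a ≠ b) (hac : a ≠ c) (hbc : b ≠ c)
    (hb : ∑ i, a i ^ 2 = ∑ i, b i ^ 2) (hc : ∑ i, a i ^ 2 = ∑ i, c i ^ 2) :
    ¬ Collinear ℝ ({a, b, c} : Set (Fin d → ℝ)) := by
  intro h
  obtain ⟨w, hw⟩ := (collinear_iff_of_mem (p₀ := a) (by simp)).1 h
  obtain ⟨r, rfl⟩ := hw b (by simp)
  obtain ⟨s, rfl⟩ := hw c (by simp)
  have expand : ∀ t : ℝ, ∑ i, (t • w +ᵥ a) i ^ 2 =
      t * (t * ∑ i, w i ^ 2 + 2 * ∑ i, w i * a i) + ∑ i, a i ^ 2 := by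
    intro t
    simp only [Finset.mul_sum, ← Finset.sum_add_distrib]
    refine Finset.sum_congr rfl fun i _ => ?_
    simp only [vadd_eq_add, Pi.add_apply, Pi.smul_apply, smul_eq_mul]
    ring
  have hr : r ≠ 0 := by rintro rfl; simp at hab
  have hs : s ≠ 0 := by rintro rfl; simp at hac
  have hrs : r - s ≠ 0 := by
    intro h0
    exact hbc (by rw [sub_eq_zero.1 h0])
  rw [expand, right_eq_add, mul_eq_zero, or_iff_right hr] at hb
  rw [expand, right_eq_add, mul_eq_zero, or_iff_right hs] at hc
  have hw0 : ∑ i, w i ^ 2 = 0 := by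
    refine (mul_eq_zero.1 ?_).resolve_left hrs
    linear_combination hb - hc
  have w_eq_zero : w = 0 := by
    ext i
    exact pow_eq_zero_iff two_ne_zero |>.1
      ((Finset.sum_eq_zero_iff_of_nonneg fun i _ => sq_nonneg (w i)).1 hw0 i (Finset.mem_univ i))
  simp [w_eq_zero] at hab

/-- Three pairwise distinct collinear points of `ℝ^d` with all coordinates in
`{1,…,ℓ}` do not all have the same signature: some value `v ∈ {1,…,ℓ}` occurs a
different number of times among the coordinates of the three points. -/
theorem collinear_triple_not_same_signature :
    ∀ (ℓ d : ℕ), 1 ≤ ℓ → 1 ≤ d →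
    ∀ a b c : Fin d → ℝ,
      (∀ i, ∃ j ∈ Finset.Icc 1 ℓ, a i = (j : ℝ)) →
      (∀ i, ∃ j ∈ Finset.Icc 1 ℓ, b i = (j : ℝ)) →
      (∀ i, ∃ j ∈ Finset.Icc 1 ℓ, c i = (j : ℝ)) →
      a ≠ b → a ≠ c → b ≠ c →
      Collinear ℝ ({a, b, c} : Set (Fin d → ℝ)) →
      ∃ v ∈ Finset.Icc 1 ℓ,
        ¬ (signature a v = signature b v ∧ signature a v = signature c v) := by
  intro ℓ d _ _ a b c ha hb hc hab hac hbc hcol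
  by_contra! hsig
  refine not_collinear_of_sum_sq_eq hab hac hbc ?_ ?_ hcol
  · rw [sum_sq_eq_sum_signature ha, sum_sq_eq_sum_signature hb]
    exact Finset.sum_congr rfl fun v hv => by rw [(hsig v hv).1]
  · rw [sum_sq_eq_sum_signature ha, sum_sq_eq_sum_signature hc]
    exact Finset.sum_congr rfl fun v hv => by rw [(hsig v hv).2]
end

section
/- Let ℓ ≥ 1 and d ≥ 1 be integers, and let [ℓ]^d = {1,…,ℓ}^d be the d-dimensional ℓ × ⋯ × ℓ integer lattice, viewed as a subset of ℝ^d. Then [ℓ]^d can be partitioned into at most (d+1)^(ℓ−1) parts such that each part contains no three collinear points (namely, the fibers of the signature map, each of which is in general position). -/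
/-- Membership in the lattice `[ℓ]^d = {1,…,ℓ}^d ⊆ ℝ^d`. -/
def InLattice (ℓ d : ℕ) (x : Fin d → ℝ) : Prop :=
  ∀ i, ∃ j ∈ Finset.Icc 1 ℓ, x i = (j : ℝ)

/-- The coordinates of `x` equal to `v + 1`. -/
noncomputable def coordsEq {d : ℕ} (x : Fin d → ℝ) (v : ℕ) : Finset (Fin d) :=
  Finset.univ.filter fun i => x i = ((v + 1 : ℕ) : ℝ)

/-- The signature of `x`, without its last entry (which the other entries determine). -/
noncomputable def truncatedSignature (ℓ d : ℕ) (x : Fin d → ℝ) : Fin (ℓ - 1) → Fin (d + 1) :=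
  fun v => ⟨(coordsEq x v).card, Nat.lt_succ_of_le (by
    simpa using Finset.card_le_univ (coordsEq x v))⟩

/-- The squared distance of a lattice point to the corner `(ℓ, …, ℓ)` is a function of its
truncated signature. -/
theorem sum_sq_sub_eq_sum_signature {ℓ d : ℕ} {x : Fin d → ℝ} (hx : InLattice ℓ d x) :
    ∑ i, (x i - ℓ) ^ 2 =
      ∑ v : Fin (ℓ - 1), ((truncatedSignature ℓ d x v : ℕ) : ℝ) * (((v + 1 : ℕ) : ℝ) - ℓ) ^ 2 := by
  have h : ∀ i, (x i - ℓ) ^ 2 =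
      ∑ v : Fin (ℓ - 1), if x i = ((v + 1 : ℕ) : ℝ) then (((v + 1 : ℕ) : ℝ) - ℓ) ^ 2 else 0 := by
    intro i
    obtain ⟨j, hj, hxj⟩ := hx i
    rw [Finset.mem_Icc] at hj
    rw [hxj]
    simp only [Nat.cast_inj]
    rcases hj.2.eq_or_lt with rfl | hlt
    · rw [Finset.sum_eq_zero]
      · simp
      · intro v _
        rw [if_neg (by omega)]
    · rw [Finset.sum_eq_single (⟨j - 1, by omega⟩ : Fin (ℓ - 1))]
      · have : j - 1 + 1 = j := by omega
        simp [this]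
      · intro v _ hv
        rw [if_neg]
        intro hjv
        apply hv
        ext
        simp [hjv]
      · simp
  rw [Finset.sum_congr rfl fun i _ => h i, Finset.sum_comm]
  refine Finset.sum_congr rfl fun v _ => ?_
  rw [← Finset.sum_filter, Finset.sum_const, nsmul_eq_mul]
  rfl

/-- A line meets a sphere in at most two points. -/
theorem card_le_two_of_collinear_of_sum_sq_eq {ι : Type*} [Fintype ι] {S : Finset (ι → ℝ)}
    (hS : Collinear ℝ (S : Set (ι → ℝ))) (c : ι → ℝ)
    (h : ∀ x ∈ S, ∀ y ∈ S, ∑ i, (x i - c i) ^ 2 = ∑ i, (y i - c i) ^ 2) : S.card ≤ 2 := by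
  by_contra! hcard
  obtain ⟨p, q, r, hp, hq, hr, hpq, hpr, hqr⟩ := Finset.two_lt_card_iff.1 hcard
  obtain ⟨v, hv⟩ := (collinear_iff_of_mem (Finset.mem_coe.2 hp)).1 hS
  have key : ∀ y ∈ S, y ≠ p → ∃ t : ℝ, y = t • v +ᵥ p ∧
      t * ∑ i, v i ^ 2 + 2 * ∑ i, v i * (p i - c i) = 0 := by
    intro y hy hyp
    obtain ⟨t, ht⟩ := hv y hy
    refine ⟨t, ht, ?_⟩
    have ht0 : t ≠ 0 := by
      rintro rfl
      exact hyp (by simpa using ht)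
    have hsum := h y hy p hp
    have hexp : ∑ i, (y i - c i) ^ 2 = t * (t * ∑ i, v i ^ 2 + 2 * ∑ i, v i * (p i - c i))
        + ∑ i, (p i - c i) ^ 2 := by
      simp only [Finset.mul_sum, ← Finset.sum_add_distrib]
      refine Finset.sum_congr rfl fun i _ => ?_
      rw [ht]
      simp only [vadd_eq_add, Pi.add_apply, Pi.smul_apply, smul_eq_mul]
      ring
    have hmul : t * (t * ∑ i, v i ^ 2 + 2 * ∑ i, v i * (p i - c i)) = 0 := by linarith
    exact (mul_eq_zero.1 hmul).resolve_left ht0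
  obtain ⟨s, hs, hs'⟩ := key q hq hpq.symm
  obtain ⟨t, ht, ht'⟩ := key r hr hpr.symm
  have hst : s - t ≠ 0 := by
    intro hst
    exact hqr (by rw [hs, ht, sub_eq_zero.1 hst])
  have hmul : (s - t) * ∑ i, v i ^ 2 = 0 := by linarith
  have hzero := (mul_eq_zero.1 hmul).resolve_left hst
  rw [Finset.sum_eq_zero_iff_of_nonneg fun i _ => sq_nonneg (v i)] at hzero
  have hv0 : v = 0 := funext fun i => pow_eq_zero_iff two_ne_zero |>.1 (hzero i (Finset.mem_univ i))
  exact hpq (by rw [hs, hv0]; simp)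


/-- The lattice `[ℓ]^d` can be partitioned into at most `(d+1)^(ℓ−1)` parts, each
containing no three collinear points. The partition is given by a colouring `χ` with
colours `< (d+1)^(ℓ−1)`, each colour class being in general position. -/
theorem lattice_colouring :
    ∀ ℓ d : ℕ, 1 ≤ ℓ → 1 ≤ d →
    ∃ χ : (Fin d → ℝ) → ℕ,
      (∀ x, InLattice ℓ d x → χ x < (d + 1) ^ (ℓ - 1)) ∧
      ∀ m : ℕ, ∀ S : Finset (Fin d → ℝ),
        (∀ x ∈ S, InLattice ℓ d x ∧ χ x = m) →
        Collinear ℝ (S : Set (Fin d → ℝ)) → S.card ≤ 2 := by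
  intro ℓ d _ _
  refine ⟨fun x => finFunctionFinEquiv (truncatedSignature ℓ d x), fun x _ => Fin.is_lt _, ?_⟩
  intro m S hS hcol
  refine card_le_two_of_collinear_of_sum_sq_eq hcol (fun _ => (ℓ : ℝ)) fun x hx y hy => ?_
  have hsig : truncatedSignature ℓ d x = truncatedSignature ℓ d y :=
    finFunctionFinEquiv.injective (Fin.ext ((hS x hx).2.trans (hS y hy).2.symm))
  rw [sum_sq_sub_eq_sum_signature (hS x hx).1, sum_sq_sub_eq_sum_signature (hS y hy).1, hsig]
end
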